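/- Let G = (S, E) be the graph with S = {s^1, s^2, s^3, s^4} and E = {{s^1,s^3}, {s^3,s^4}, {s^2,s^4}}, and let μ be the probability distribution on S with μ(s^1) = μ(s^2) = 1/2 and μ(s^3) = μ(s^4) = 0. Let X = (X(t) : t ∈ ℕ) be the non-homogeneous Markov chain on S with arbitrary initial distribution whose one-step transition matrix at time ℓ is P^{(μ_{2^ℓ}, G)}. Then P( ⋂_{s ∈ S} { lim_{t→∞} (1/t) Σ_{m=0}^{t−1} 1_{{X(m)=s}} = μ(s) } ) = 0, i.e. the empirical distribution of X almost surely fails to converge to μ at some state. -/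

import Mathlib

open Finset Filter MeasureTheory

attribute [local instance] Classical.propDecidable

/-- `k̄ = ⌈1 / min{μ(s) : s ∈ S, μ(s) > 0}⌉`. -/
noncomputable def suppMinCeil {N : ℕ} (μ : Fin N → ℝ) : ℕ :=
  ⌈1 / sInf (μ '' {s | 0 < μ s})⌉₊

/-- `A_k = {s ∈ S : μ(s) < 1/k}`. -/
noncomputable def Ak {N : ℕ} (μ : Fin N → ℝ) (k : ℕ) : Finset (Fin N) :=
  Finset.univ.filter fun s => μ s < 1 / (k : ℝ)

/-- `η_k`, the uniform distribution on `A_k`. -/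
noncomputable def etak {N : ℕ} (μ : Fin N → ℝ) (k : ℕ) : Fin N → ℝ :=
  fun s => if s ∈ Ak μ k then 1 / ((Ak μ k).card : ℝ) else 0

/-- `μ_k = (1/k) η_k + ((k-1)/k) μ`. -/
noncomputable def muk {N : ℕ} (μ : Fin N → ℝ) (k : ℕ) : Fin N → ℝ :=
  fun s => (1 / (k : ℝ)) * etak μ k s + (((k : ℝ) - 1) / k) * μ s

/-- The denominator appearing in the definition of the constant `p`:
`Σ_{m>l} 1_{{s^l,s^m} ∈ E} + Σ_{m<l} (ν(s^m)/ν(s^l)) 1_{{s^l,s^m} ∈ E}`. -/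
noncomputable def denomP {V : Type*} [Fintype V] [LinearOrder V]
    (G : SimpleGraph V) (ν : V → ℝ) (l : V) : ℝ :=
  (∑ m, if l < m ∧ G.Adj l m then (1 : ℝ) else 0)
    + ∑ m, if m < l ∧ G.Adj l m then ν m / ν l else 0

/-- The constant `p = min_l 1/(2 · denom(l))`. -/
noncomputable def pconst {V : Type*} [Fintype V] [LinearOrder V]
    (G : SimpleGraph V) (ν : V → ℝ) : ℝ :=
  ⨅ l, 1 / (2 * denomP G ν l)

/-- The transition matrix `P^{(ν,G)}`. -/
noncomputable def Pmat {V : Type*} [Fintype V] [LinearOrder V]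
    (G : SimpleGraph V) (ν : V → ℝ) : Matrix V V ℝ :=
  Matrix.of fun l m =>
    if l = m then 1 - pconst G ν * denomP G ν l
    else if l < m ∧ G.Adj l m then pconst G ν
    else if m < l ∧ G.Adj l m then (ν m / ν l) * pconst G ν
    else 0

/-- `X = (X(t) : t ∈ ℕ)` is a (possibly non-homogeneous) Markov chain with one-step
transition matrix `T t` at time `t` (and arbitrary initial distribution, namely the
law of `X 0`): the finite-dimensional distributions factorize as
`P(X_0 = x_0, …, X_{n+1} = x_{n+1}) = P(X_0 = x_0) ∏_{i=0}^{n} T i (x_i, x_{i+1})`. -/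
def IsMarkovOn {Ω S : Type*} [MeasurableSpace Ω] (P : MeasureTheory.Measure Ω)
    (X : ℕ → Ω → S) (T : ℕ → Matrix S S ℝ) : Prop :=
  ∀ (n : ℕ) (path : ℕ → S),
    (P {ω | ∀ i ≤ n + 1, X i ω = path i}).toReal
      = (P {ω | X 0 ω = path 0}).toReal
        * ∏ i ∈ Finset.range (n + 1), T i (path i) (path (i + 1))

/-- The process `X` is consistent with the graph `G`: with probability one,
`X(t)` and `X(t+1)` are adjacent in `G` (i.e. equal or joined by an edge). -/
def ConsistentWith {Ω V : Type*} [MeasurableSpace Ω] (P : MeasureTheory.Measure Ω)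
    (X : ℕ → Ω → V) (G : SimpleGraph V) : Prop :=
  ∀ t : ℕ, P {ω | X t ω = X (t + 1) ω ∨ G.Adj (X t ω) (X (t + 1) ω)} = 1

/-- The one-step transition law of a Markov chain, recovered from its path probabilities. -/
theorem IsMarkovOn.measureReal_step {Ω S : Type*} [Fintype S] [MeasurableSpace S]
    [MeasurableSingletonClass S] [MeasurableSpace Ω] {P : Measure Ω} [IsProbabilityMeasure P]
    {X : ℕ → Ω → S} {T : ℕ → Matrix S S ℝ} (h : IsMarkovOn P X T) (hX : ∀ t, Measurable (X t))
    (n : ℕ) (a b : S) :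
    P.real {ω | X n ω = a ∧ X (n + 1) ω = b} = P.real {ω | X n ω = a} * T n a b := by
  have hpath : ∀ path : ℕ → S, P.real {ω | ∀ i ≤ n + 1, X i ω = path i}
      = P.real {ω | ∀ i ≤ n, X i ω = path i} * T n (path n) (path (n + 1)) := by
    intro path
    have h1 := h n path
    rw [Finset.prod_range_succ, ← mul_assoc] at h1
    rw [measureReal_def, h1]
    congr 1
    cases n with
    | zero => simp [measureReal_def]
    | succ n => exact (h n path).symm
  let Y : Ω → (Fin (n + 1) → S) := fun ω i => X i ω
  have hY : Measurable Y := measurable_pi_lambda _ fun i => hX i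
  have hsum : ∀ A : Set Ω, P.real A = ∑ y, P.real (Y ⁻¹' {y} ∩ A) := by
    intro A
    have := sum_measureReal_preimage_singleton (μ := P.restrict A) (f := Y) Finset.univ
      (fun y _ => hY (measurableSet_singleton y))
    simp only [Finset.coe_univ, Set.preimage_univ, measureReal_restrict_apply_univ] at this
    rw [← this]
    exact Finset.sum_congr rfl fun y _ =>
      measureReal_restrict_apply (hY (measurableSet_singleton y))
  rw [hsum {ω | X n ω = a ∧ X (n + 1) ω = b}, hsum {ω | X n ω = a}, Finset.sum_mul]
  refine Finset.sum_congr rfl fun y _ => ?_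
  by_cases hy : y (Fin.last n) = a
  · let path : ℕ → S := fun i => if hi : i < n + 1 then y ⟨i, hi⟩ else b
    have hlt : ∀ i (hi : i < n + 1), path i = y ⟨i, hi⟩ := fun i hi => dif_pos hi
    have hn : path n = a := (hlt n n.lt_succ_self).trans hy
    have hn1 : path (n + 1) = b := dif_neg (lt_irrefl _)
    have hYy : ∀ ω, Y ω = y ↔ ∀ i ≤ n, X i ω = path i := by
      intro ω
      constructor
      · intro hω i hi
        rw [hlt i (by omega), ← hω]
      · intro hω
        funext i
        exact (hω i (by omega)).trans (hlt i i.2)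
    have e1 : Y ⁻¹' {y} ∩ {ω | X n ω = a ∧ X (n + 1) ω = b}
        = {ω | ∀ i ≤ n + 1, X i ω = path i} := by
      ext ω
      simp only [Set.mem_inter_iff, Set.mem_preimage, Set.mem_singleton_iff, Set.mem_ofPred_eq, hYy]
      constructor
      · rintro ⟨h1, -, h2⟩ i hi
        rcases Nat.le_succ_iff.1 hi with hi | rfl
        · exact h1 i hi
        · exact h2.trans hn1.symm
      · intro h1
        exact ⟨fun i hi => h1 i (by omega), (h1 n (by omega)).trans hn, (h1 _ le_rfl).trans hn1⟩
    have e2 : Y ⁻¹' {y} ∩ {ω | X n ω = a} = {ω | ∀ i ≤ n, X i ω = path i} := by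
      ext ω
      simp only [Set.mem_inter_iff, Set.mem_preimage, Set.mem_singleton_iff, Set.mem_ofPred_eq, hYy]
      exact ⟨fun h1 => h1.1, fun h1 => ⟨h1, (h1 n le_rfl).trans hn⟩⟩
    rw [e1, e2, hpath, hn, hn1]
  · have e : Y ⁻¹' {y} ∩ {ω | X n ω = a} = ∅ := by
      ext ω
      simp only [Set.mem_inter_iff, Set.mem_preimage, Set.mem_singleton_iff, Set.mem_ofPred_eq,
        Set.mem_empty_iff_false, iff_false, not_and]
      rintro rfl h1
      exact hy h1
    have e' : Y ⁻¹' {y} ∩ {ω | X n ω = a ∧ X (n + 1) ω = b} = ∅ :=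
      Set.eq_empty_of_subset_empty (e ▸ Set.inter_subset_inter_right _ fun ω hω => hω.1)
    rw [e, e']
    simp

/-- A state which is eventually never visited has limiting frequency zero. -/
theorem tendsto_frequency_zero_of_eventually_ne {S : Type*} [DecidableEq S] {x : ℕ → S} {s : S}
    (h : ∀ᶠ m in atTop, x m ≠ s) :
    Tendsto (fun t : ℕ => (∑ m ∈ Finset.range t, if x m = s then (1 : ℝ) else 0) / t)
      atTop (nhds 0) := by
  have h0 : Tendsto (fun m => if x m = s then (1 : ℝ) else 0) atTop (nhds 0) :=
    tendsto_const_nhds.congr' (h.mono fun m hm => (if_neg hm).symm)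
  simpa [div_eq_inv_mul] using h0.cesaro

/-- On the path `0 - 2 - 3 - 1`, the probability of leaving the state `0` at time `t`
is at most `2⁻ᵗ`. -/
theorem one_sub_Pmat_zero_zero_le (G : SimpleGraph (Fin 4))
    (hG : ∀ a b : Fin 4, G.Adj a b ↔
      s(a, b) = s((0 : Fin 4), (2 : Fin 4)) ∨
      s(a, b) = s((2 : Fin 4), (3 : Fin 4)) ∨
      s(a, b) = s((1 : Fin 4), (3 : Fin 4)))
    {t : ℕ} (ht : 1 ≤ t) :
    1 - Pmat G (muk ![1 / 2, 1 / 2, 0, 0] (2 ^ t)) 0 0 ≤ (1 / 2) ^ t := by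
  have h2 : (2 : ℝ) ≤ 2 ^ t := by simpa using pow_le_pow_right₀ (one_le_two (α := ℝ)) ht
  have hA : Ak ![1 / 2, 1 / 2, 0, 0] (2 ^ t) = {2, 3} := by
    have h3 : ¬ ((1 : ℝ) / 2 < 1 / 2 ^ t) :=
      not_lt.2 (one_div_le_one_div_of_le two_pos h2)
    ext s
    fin_cases s <;> simp_all [Ak]
  set ν := muk ![1 / 2, 1 / 2, 0, 0] (2 ^ t) with hν
  have hν0 : ν 0 = (2 ^ t - 1) / 2 ^ t * (1 / 2) := by
    simp only [hν, muk, etak, hA]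
    simp
  have hν2 : ν 2 = 1 / 2 ^ t * (1 / 2) := by
    simp only [hν, muk, etak, hA]
    simp
  have hd0 : denomP G ν 0 = 1 := by
    simp [-Finset.sum_boole, denomP, Fin.sum_univ_four, hG]
  have hd2 : denomP G ν 2 = 2 ^ t := by
    have : denomP G ν 2 = 1 + ν 0 / ν 2 := by
      simp [-Finset.sum_boole, denomP, Fin.sum_univ_four, hG]
    rw [this, hν0, hν2]
    field_simp
    ring
  have hp : pconst G ν ≤ 1 / (2 * denomP G ν 2) := ciInf_le (Set.finite_range _).bddBelow 2
  have hP : Pmat G ν 0 0 = 1 - pconst G ν := by simp [Pmat, hd0]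
  rw [hP, sub_sub_cancel, one_div_pow]
  refine hp.trans (one_div_le_one_div_of_le (by positivity) ?_)
  rw [hd2]
  linarith

theorem stmt_19 (G : SimpleGraph (Fin 4))
    (hG : ∀ a b : Fin 4, G.Adj a b ↔
      s(a, b) = s((0 : Fin 4), (2 : Fin 4)) ∨
      s(a, b) = s((2 : Fin 4), (3 : Fin 4)) ∨
      s(a, b) = s((1 : Fin 4), (3 : Fin 4)))
    (μ : Fin 4 → ℝ) (hμ : μ = ![1 / 2, 1 / 2, 0, 0])
    {Ω : Type*} [MeasurableSpace Ω] (P : Measure Ω) [IsProbabilityMeasure P]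
    (X : ℕ → Ω → Fin 4) (hX : ∀ t, Measurable (X t))
    (hMarkov : IsMarkovOn P X fun ℓ => Pmat G (muk μ (2 ^ ℓ))) :
    P {ω | ∀ s : Fin 4,
        Tendsto (fun t : ℕ => (∑ m ∈ Finset.range t, if X m ω = s then (1 : ℝ) else 0) / t)
          atTop (nhds (μ s))} = 0 := by
  have hleave : ∀ t, P {ω | X t ω = 0 ∧ X (t + 1) ω ≠ 0} ≤ ENNReal.ofReal ((1 / 2) ^ t) := by
    intro t
    rcases Nat.eq_zero_or_pos t with rfl | ht
    · simpa using prob_le_one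
    · rw [← ofReal_measureReal]
      refine ENNReal.ofReal_le_ofReal ?_
      have hdiff : {ω | X t ω = 0 ∧ X (t + 1) ω ≠ 0}
          = {ω | X t ω = 0} \ {ω | X t ω = 0 ∧ X (t + 1) ω = 0} := by
        ext ω
        simp only [Set.mem_ofPred_eq, Set.mem_sdiff]
        tauto
      have h0 : MeasurableSet {ω | X t ω = 0} := hX t (measurableSet_singleton 0)
      have h1 : MeasurableSet {ω | X (t + 1) ω = 0} := hX (t + 1) (measurableSet_singleton 0)
      have hsub : {ω | X t ω = 0 ∧ X (t + 1) ω = 0} ⊆ {ω | X t ω = 0} := fun ω hω => hω.1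
      rw [hdiff, measureReal_sdiff hsub (h0.inter h1),
        hMarkov.measureReal_step hX t 0 0]
      have hle := one_sub_Pmat_zero_zero_le G hG ht
      rw [← hμ] at hle
      have hpos : (0 : ℝ) ≤ (1 / 2) ^ t := by positivity
      have hP0 : 0 ≤ P.real {ω | X t ω = 0} := measureReal_nonneg
      have hP1 : P.real {ω | X t ω = 0} ≤ 1 := measureReal_le_one
      nlinarith [mul_le_mul_of_nonneg_left hle hP0, mul_le_mul_of_nonneg_right hP1 hpos]
  have hsum : ∑' t, P {ω | X t ω = 0 ∧ X (t + 1) ω ≠ 0} ≠ ⊤ :=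
    ne_top_of_le_ne_top summable_geometric_two.tsum_ofReal_ne_top (ENNReal.tsum_le_tsum hleave)
  refine measure_mono_null ?_ (measure_setOfPred_frequently_eq_zero hsum)
  intro ω hω
  by_contra hfin
  have hstay : ∀ᶠ t in atTop, ¬ (X t ω = 0 ∧ X (t + 1) ω ≠ 0) := not_frequently.1 hfin
  obtain ⟨t₀, ht₀⟩ := eventually_atTop.1 hstay
  by_cases hvisit : ∃ t₁ ≥ t₀, X t₁ ω = 0
  · obtain ⟨t₁, ht₁, hx⟩ := hvisit
    have hzero : ∀ t ≥ t₁, X t ω = 0 := by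
      intro t ht
      induction t, ht using Nat.le_induction with
      | base => exact hx
      | succ t ht ih => exact not_not.1 fun hne => ht₀ t (ht₁.trans ht) ⟨ih, hne⟩
    have hlim := tendsto_frequency_zero_of_eventually_ne (x := fun t => X t ω) (s := 1)
      (eventually_atTop.2 ⟨t₁, fun t ht => by simp [hzero t ht]⟩)
    have := tendsto_nhds_unique (hω 1) hlim
    norm_num [hμ] at this
  · push Not at hvisit
    have hlim := tendsto_frequency_zero_of_eventually_ne (x := fun t => X t ω) (s := 0)
      (eventually_atTop.2 ⟨t₀, hvisit⟩)
    have := tendsto_nhds_unique (hω 0) hlim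
    norm_num [hμ] at this
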